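/- Let G be a word-hyperbolic group and let H be a finitely generated torsion-free subgroup of G. Then the Frattini subgroup F(H) of H is trivial. -/

import Mathlib

/-- The word length of `g` with respect to a generating set `S`:
the least `n` such that `g` is a product of `n` elements of `S ∪ S⁻¹`. -/
noncomputable def wordLength {G : Type*} [Group G] (S : Set G) (g : G) : ℕ :=
  sInf {n : ℕ | ∃ l : List G, l.length = n ∧ (∀ x ∈ l, x ∈ S ∨ x⁻¹ ∈ S) ∧ l.prod = g}

/-- The word metric on `G` with respect to a generating set `S`. -/
noncomputable def wordDist {G : Type*} [Group G] (S : Set G) (g h : G) : ℕ :=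
  wordLength S (g⁻¹ * h)

/-- The word metric on `G` w.r.t. `S` satisfies the Gromov
four-point condition with constant `δ`. -/
def GromovFourPoint {G : Type*} [Group G] (S : Set G) (δ : ℝ) : Prop :=
  ∀ x y z w : G,
    (wordDist S x y : ℝ) + (wordDist S z w : ℝ) ≤
      max ((wordDist S x z : ℝ) + (wordDist S y w : ℝ))
          ((wordDist S x w : ℝ) + (wordDist S y z : ℝ)) + 2 * δ

/-- A group is word-hyperbolic if it has a finite generating set whose
word metric satisfies the Gromov four-point condition for some `δ ≥ 0`. -/
def IsWordHyperbolic (G : Type*) [Group G] : Prop :=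
  ∃ S : Finset G, Subgroup.closure (S : Set G) = ⊤ ∧
    ∃ δ : ℝ, 0 ≤ δ ∧ GromovFourPoint (S : Set G) δ



structure HypLen (Γ : Type*) [Group Γ] where
  len : Γ → ℕ
  D : ℕ
  len_one : len 1 = 0
  len_inv : ∀ g, len g⁻¹ = len g
  len_mul : ∀ g h, len (g * h) ≤ len g + len h
  fin : ∀ r : ℕ, {g | len g ≤ r}.Finite
  four : ∀ x y z w : Γ,
    len (x⁻¹ * y) + len (z⁻¹ * w) ≤ len (x⁻¹ * z) + len (y⁻¹ * w) + D ∨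
    len (x⁻¹ * y) + len (z⁻¹ * w) ≤ len (x⁻¹ * w) + len (y⁻¹ * z) + D

namespace HypLen

variable {Γ : Type*} [Group Γ] (L : HypLen Γ)

def d (x y : Γ) : ℕ := L.len (x⁻¹ * y)

lemma d_one (x : Γ) : L.d 1 x = L.len x := by simp [d]

lemma d_self (x : Γ) : L.d x x = 0 := by simp [d, L.len_one]

lemma d_comm (x y : Γ) : L.d x y = L.d y x := by
  unfold d; rw [← L.len_inv]; simp

lemma d_one' (x : Γ) : L.d x 1 = L.len x := by rw [d_comm, d_one]

lemma d_tri (x y z : Γ) : L.d x z ≤ L.d x y + L.d y z := by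
  unfold d
  have := L.len_mul (x⁻¹ * y) (y⁻¹ * z)
  simpa [mul_assoc] using this

lemma d_left (g x y : Γ) : L.d (g * x) (g * y) = L.d x y := by
  unfold d; simp [mul_assoc]

lemma d_right (x y : Γ) : L.d x (x * y) = L.len y := by
  unfold d; simp

/-- twice the Gromov product of `y` and `z` based at `x` -/
def gp (x y z : Γ) : ℤ := (L.d x y : ℤ) + L.d x z - L.d y z

lemma gp_comm (x y z : Γ) : L.gp x y z = L.gp x z y := by
  unfold gp; rw [L.d_comm y z]; ring

lemma gp_left (g x y z : Γ) : L.gp (g * x) (g * y) (g * z) = L.gp x y z := by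
  unfold gp; simp only [d_left]

lemma gp_nonneg (x y z : Γ) : 0 ≤ L.gp x y z := by
  have := L.d_tri y x z
  rw [L.d_comm y x] at this
  unfold gp; omega

lemma gp_hyp (x y z w : Γ) :
    L.gp x y z - L.D ≤ L.gp x y w ∨ L.gp x z w - L.D ≤ L.gp x y w := by
  have h := L.four y w x z
  change L.d y w + L.d x z ≤ L.d y x + L.d w z + _ ∨ L.d y w + L.d x z ≤ L.d y z + L.d w x + _ at h
  rw [L.d_comm y x, L.d_comm w z, L.d_comm w x] at h
  unfold gp; omega

lemma gp_base (x x' y z : Γ) : L.gp x y z ≤ L.gp x' y z + 2 * L.d x x' := by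
  have h1 := L.d_tri x x' y
  have h2 := L.d_tri x x' z
  unfold gp; omega

lemma gp_pt (x y y' z : Γ) : L.gp x y z ≤ L.gp x y' z + 2 * L.d y y' := by
  have h1 := L.d_tri x y' y
  have h2 := L.d_tri y' y z
  have h3 := L.d_comm y y'
  unfold gp; omega

lemma gp_le (x y z : Γ) : L.gp x y z ≤ 2 * L.d x y := by
  have h1 := L.d_tri x y z
  unfold gp; omega

lemma gp_ge (x y z : Γ) : 2 * (L.d x y : ℤ) - 2 * L.d y z ≤ L.gp x y z := by
  have h1 := L.d_tri x z y
  have h2 := L.d_comm y z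
  unfold gp; omega

/-- chain step -/
lemma step (w t s : Γ) (a : ℕ) (h0 : L.len w + 1 ≤ L.len (w * t))
    (h1 : L.len t + (L.D + a) ≤ L.len (t * s)) (h2 : L.len s + (L.D + a) ≤ L.len (t * s)) :
    L.len (w * t) + a ≤ L.len (w * t * s) := by
  have h := L.four 1 (w * t) w (w * t * s)
  simp only [inv_one, one_mul, mul_inv_rev, mul_assoc, inv_mul_cancel_left, inv_mul_cancel,
    mul_one] at h
  have e : L.len t⁻¹ = L.len t := L.len_inv t
  simp only [mul_assoc] at *
  rw [e] at h
  omega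

def Lox (g : Γ) : Prop :=
  ∃ C : ℕ, (∀ n : ℕ, n ≤ L.len (g ^ n)) ∧ ∀ m n : ℕ, L.gp 1 (g ^ m)⁻¹ (g ^ n) ≤ C

lemma len_pow_le (g : Γ) (n : ℕ) : L.len (g ^ n) ≤ n * L.len g := by
  induction n with
  | zero => simp [L.len_one]
  | succ n ih => rw [pow_succ]; have := L.len_mul (g ^ n) g; linarith

lemma lox_of (g : Γ) (hg : L.len g + (2 * L.D + 1) ≤ L.len (g * g)) : L.Lox g := by
  have hgr : ∀ n : ℕ, L.len (g ^ n) + (L.D + 1) ≤ L.len (g ^ (n + 1)) := by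
    intro n
    induction n with
    | zero =>
      have := L.len_mul g g
      simp [L.len_one]; omega
    | succ n ih =>
      rw [pow_succ] at ih
      rw [pow_succ _ (n+1), pow_succ]
      exact L.step _ _ _ (L.D + 1) (by omega) (by omega) (by omega)
  refine ⟨L.len g + 2 * L.D, ?_, ?_⟩
  · intro n
    induction n with
    | zero => simp
    | succ n ih => have := hgr n; omega
  · have key : ∀ n : ℕ, (L.len g : ℤ) + L.D + 1 ≤ L.gp 1 (g ^ (n+1)) g := by
      intro n
      have h1 : L.d (g ^ (n+1)) g = L.len (g ^ n) := by
        rw [d_comm, pow_succ', d_right]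
      have := hgr n
      unfold gp
      rw [h1, d_one, d_one]; omega
    have key' : ∀ n : ℕ, (L.len g : ℤ) + L.D + 1 ≤ L.gp 1 (g ^ (n+1))⁻¹ g⁻¹ := by
      intro n
      have h1 : L.d (g ^ (n+1))⁻¹ g⁻¹ = L.len (g ^ n) := by
        rw [d]; congr 1; rw [pow_succ]; simp
      have := hgr n
      unfold gp
      rw [h1, d_one, d_one, L.len_inv, L.len_inv]; omega
    have k0 : L.gp 1 g⁻¹ g ≤ (L.len g : ℤ) - 2 * L.D - 1 := by
      have h1 : L.d g⁻¹ g = L.len (g * g) := by simp [d]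
      unfold gp
      rw [h1, d_one, d_one, L.len_inv]; omega
    intro m n
    rcases m with _ | m
    · have := L.gp_le 1 1 (g ^ n)
      rw [d_self] at this
      simp at this ⊢; omega
    rcases n with _ | n
    · have := L.gp_le 1 1 (g ^ (m+1))⁻¹
      rw [d_self, gp_comm] at this
      simp at this ⊢; omega
    have a1 := key n
    have a2 := key' m
    have b1 := L.gp_hyp 1 g⁻¹ (g ^ (m+1))⁻¹ g
    have b2 := L.gp_hyp 1 (g ^ (m+1))⁻¹ (g ^ (n+1)) g
    rw [L.gp_comm 1 g⁻¹ (g ^ (m+1))⁻¹] at b1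
    push_cast
    omega

/-- points on quasi-geodesics -/
lemma near (g : Γ) (C : ℕ) (hC : ∀ m n : ℕ, L.gp 1 (g ^ m)⁻¹ (g ^ n) ≤ C) (x y : Γ) (n K : ℕ)
    (hy : L.gp y x (x * g ^ n) ≤ K) :
    ∃ j ≤ n, L.d y (x * g ^ j) ≤ L.len g + K + C + L.D := by
  by_cases hlt : L.len (g ^ n) < L.d x y
  · refine ⟨n, le_rfl, ?_⟩
    unfold gp at hy
    rw [d_right, L.d_comm y x] at hy
    omega
  push Not at hlt
  have hex : ∃ j, L.d x y ≤ L.len (g ^ j) := ⟨n, hlt⟩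
  classical
  obtain ⟨j, hj1, hj2⟩ : ∃ j, L.d x y ≤ L.len (g ^ j) ∧ ∀ i < j, L.len (g ^ i) < L.d x y :=
    ⟨Nat.find hex, Nat.find_spec hex, fun i hi => by simpa using Nat.find_min hex hi⟩
  have hjn : j ≤ n := by
    by_contra h
    have := hj2 n (by omega)
    omega
  refine ⟨j, hjn, ?_⟩
  have hup : L.len (g ^ j) ≤ L.d x y + L.len g := by
    rcases j with _ | j
    · simp [L.len_one]
    · have := hj2 j (by omega)
      have h2 := L.len_mul (g ^ j) g
      rw [pow_succ]; omega
  have e1 : L.d (g ^ j)⁻¹ (g ^ (n - j)) = L.len (g ^ n) := by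
    unfold d; rw [inv_inv, ← pow_add]; congr 2; omega
  have c := hC j (n - j)
  unfold gp at c hy
  rw [e1, d_one, d_one, L.len_inv] at c
  have e2 : L.d (x * g ^ j) (x * g ^ n) = L.len (g ^ (n - j)) := by
    rw [d_left]; unfold d; congr 1
    rw [inv_mul_eq_iff_eq_mul, ← pow_add]; congr 1; omega
  have h := L.four y (x * g ^ j) x (x * g ^ n)
  change L.d _ _ + L.d _ _ ≤ L.d _ _ + L.d _ _ + _ ∨ L.d _ _ + L.d _ _ ≤ L.d _ _ + L.d _ _ + _ at h
  rw [e2, d_right, L.d_comm (x * g ^ j) x, d_right, L.d_comm y x] at h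
  rw [L.d_comm y x, d_right] at hy
  omega

/-- core of the Serre type lemma -/
lemma serre_core (c R : ℕ) (s t : Γ)
    (ht : R ≤ L.len t + 2 * c) (hs : R ≤ L.len s + 2 * c)
    (hR : 100 * L.D + 30 * c + 100 ≤ R)
    (hst : L.gp 1 s t < 2 * c)
    (h1 : L.len (s * s) < L.len s + (2 * L.D + 1))
    (h2 : L.len (t * t) < L.len t + (2 * L.D + 1)) :
    L.len (s * t) + (2 * L.D + 1) ≤ L.len (s * t * (s * t)) := by
  have es : L.gp 1 s s⁻¹ = 2 * L.len s - L.len (s * s) := by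
    unfold gp; rw [L.d_comm s]; unfold d; simp [L.len_inv]; ring
  have et : L.gp 1 t⁻¹ t = 2 * L.len t - L.len (t * t) := by
    unfold gp d; simp [L.len_inv]; ring
  have a1 := L.gp_hyp 1 s t⁻¹ t
  have a2 := L.gp_hyp 1 s s⁻¹ t
  have e1 : L.gp 1 s⁻¹ t = L.len s + L.len t - L.len (s * t) := by
    unfold gp d; simp [L.len_inv]
  have e2 : L.gp 1 s t⁻¹ = L.len s + L.len t - L.len (t * s) := by
    rw [gp_comm]; unfold gp d; simp [L.len_inv]; ring
  have q1 : L.len s + (2 * L.D + 1) ≤ L.len (s * t) := by omega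
  have q2 : L.len t + (2 * L.D + 1) ≤ L.len (s * t) := by omega
  have q3 : L.len s + (2 * L.D + 1) ≤ L.len (t * s) := by omega
  have q4 : L.len t + (2 * L.D + 1) ≤ L.len (t * s) := by omega
  have b1 := L.step s t s (L.D + 1) (by omega) (by omega) (by omega)
  have b2 := L.step (s * t) s t (L.D + 1) (by omega) (by omega) (by omega)
  rw [mul_assoc (s * t) s t] at b2
  omega

lemma serre_aux (s0 s y : Γ) (R : ℕ) (hR : 200 * L.D + 300 ≤ R)
    (h0 : L.len s0 = R) (hs : L.len s ≤ R) (hy : L.len y = 2 * L.D + 2)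
    (hy0 : L.len (y⁻¹ * s0) + (2 * L.D + 2) = R) (hysy : R ≤ L.len (y⁻¹ * s * y))
    (h1 : L.len (s0 * s0) < L.len s0 + (2 * L.D + 1))
    (h2 : L.len (s * s) < L.len s + (2 * L.D + 1))
    (h3 : L.len (s0 * s * (s0 * s)) < L.len (s0 * s) + (2 * L.D + 1))
    (h4 : L.len (s0 * s⁻¹ * (s0 * s⁻¹)) < L.len (s0 * s⁻¹) + (2 * L.D + 1)) : False := by
  have hs' : R ≤ L.len s + 2 * (2 * L.D + 2) := by
    have a := L.len_mul (y⁻¹ * s) y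
    have b := L.len_mul y⁻¹ s
    rw [L.len_inv] at b
    omega
  have n1 : ¬ L.gp 1 s0 s < 2 * (2 * L.D + 2 : ℕ) := by
    intro h
    have := L.serre_core (2 * L.D + 2) R s0 s hs' (by omega) (by omega) h h1 h2
    omega
  have n2 : ¬ L.gp 1 s0 s⁻¹ < 2 * (2 * L.D + 2 : ℕ) := by
    intro h
    have h2' : L.len (s⁻¹ * s⁻¹) < L.len s⁻¹ + (2 * L.D + 1) := by
      rw [← mul_inv_rev, L.len_inv, L.len_inv]; exact h2
    have := L.serre_core (2 * L.D + 2) R s0 s⁻¹ (by rw [L.len_inv]; exact hs')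
      (by omega) (by omega) h h1 h2'
    omega
  have ey : L.gp 1 y s0 = 2 * (2 * L.D + 2 : ℕ) := by
    unfold gp; rw [d_one, d_one]; unfold d; omega
  have a1 := L.gp_hyp 1 y s0 s
  have a2 := L.gp_hyp 1 y s0 s⁻¹
  have f := L.four y (s * y) 1 s
  have e1 : L.gp 1 y s = L.len y + L.len s - L.len (y⁻¹ * s) := by
    unfold gp d; simp
  have e2 : L.gp 1 y s⁻¹ = L.len y + L.len s - L.len (s * y) := by
    rw [gp_comm]; unfold gp d; simp [L.len_inv]; ring
  simp only [mul_inv_rev, inv_one, one_mul, mul_one, L.len_inv, ← mul_assoc,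
    inv_mul_cancel_right] at f
  have e3 : L.len (y⁻¹ * s⁻¹) = L.len (s * y) := by rw [← mul_inv_rev, L.len_inv]
  rw [e3] at f
  omega

lemma serre (geod : ∀ g : Γ, ∀ n : ℕ, n ≤ L.len g → ∃ x, L.len x = n ∧ L.len (x⁻¹ * g) + n = L.len g)
    (N : Subgroup Γ)
    (hN : ∀ x : Γ, ∀ g ∈ N, L.len (x⁻¹ * (g * g) * x) < L.len (x⁻¹ * g * x) + (2 * L.D + 1))
    (S : Finset Γ) (hS : ∀ s ∈ S, s ∈ N) :
    ∃ x, ∀ s ∈ S, L.len (x⁻¹ * s * x) ≤ 200 * L.D + 300 := by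
  classical
  let f : Γ → ℕ := fun x => S.sup (fun s => L.len (x⁻¹ * s * x))
  obtain ⟨x, hx⟩ : ∃ x, ∀ y, f x ≤ f y := ⟨Function.argmin f, fun y => Function.argmin_le f y⟩
  refine ⟨x, ?_⟩
  by_contra hcon
  push Not at hcon
  obtain ⟨s1, hs1, hs1'⟩ := hcon
  obtain ⟨s0, hs0, hs0'⟩ := Finset.exists_mem_eq_sup S ⟨s1, hs1⟩ (fun s => L.len (x⁻¹ * s * x))
  have hle : ∀ s ∈ S, L.len (x⁻¹ * s * x) ≤ f x := fun s hs =>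
    Finset.le_sup (f := fun s => L.len (x⁻¹ * s * x)) hs
  change f x = _ at hs0'
  have hbig := hle s1 hs1
  obtain ⟨y, hy1, hy2⟩ := geod (x⁻¹ * s0 * x) (2 * L.D + 2) (by omega)
  obtain ⟨s, hs, hsy⟩ := Finset.exists_mem_eq_sup S ⟨s1, hs1⟩ (fun s => L.len ((x * y)⁻¹ * s * (x * y)))
  have hm := hx (x * y)
  change f (x * y) = _ at hsy
  have conj : ∀ g ∈ N, L.len (x⁻¹ * g * x * (x⁻¹ * g * x)) < L.len (x⁻¹ * g * x) + (2 * L.D + 1) := by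
    intro g hg
    have := hN x g hg
    have e : x⁻¹ * g * x * (x⁻¹ * g * x) = x⁻¹ * (g * g) * x := by group
    rw [e]; exact this
  refine L.serre_aux (x⁻¹ * s0 * x) (x⁻¹ * s * x) y (f x) (by omega) hs0'.symm (hle s hs) hy1
    (by omega) ?_ (conj _ (hS _ hs0)) (conj _ (hS _ hs)) ?_ ?_
  · have e : y⁻¹ * (x⁻¹ * s * x) * y = (x * y)⁻¹ * s * (x * y) := by group
    rw [e]; omega
  · have := conj (s0 * s) (N.mul_mem (hS _ hs0) (hS _ hs))
    have e : x⁻¹ * s0 * x * (x⁻¹ * s * x) = x⁻¹ * (s0 * s) * x := by group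
    rw [e]; exact this
  · have := conj (s0 * s⁻¹) (N.mul_mem (hS _ hs0) (N.inv_mem (hS _ hs)))
    have e : x⁻¹ * s0 * x * (x⁻¹ * s * x)⁻¹ = x⁻¹ * (s0 * s⁻¹) * x := by group
    rw [e]; exact this

def conj (x : Γ) : HypLen Γ where
  len g := L.len (x⁻¹ * g * x)
  D := L.D
  len_one := by simp [L.len_one]
  len_inv g := by rw [← L.len_inv (x⁻¹ * g * x)]; congr 1; group
  len_mul g h := by
    have := L.len_mul (x⁻¹ * g * x) (x⁻¹ * h * x)
    have e : x⁻¹ * g * x * (x⁻¹ * h * x) = x⁻¹ * (g * h) * x := by group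
    rwa [e] at this
  fin r := by
    refine Set.Finite.of_finite_image (f := fun g => x⁻¹ * g * x) ((L.fin r).subset ?_) ?_
    · rintro _ ⟨g, hg, rfl⟩; exact hg
    · intro a _ b _ h; simpa using h
  four a b c e := by
    have := L.four (a * x) (b * x) (c * x) (e * x)
    simpa only [mul_inv_rev, mul_assoc] using this

def restrict (H : Subgroup Γ) : HypLen H where
  len g := L.len g
  D := L.D
  len_one := L.len_one
  len_inv g := L.len_inv g
  len_mul g h := L.len_mul g h
  fin r := (L.fin r).preimage Subtype.val_injective.injOn
  four a b c e := L.four a b c e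

/-- an infinite subgroup contains a loxodromic element, for a suitable base point -/
lemma exists_lox
    (geod : ∀ g : Γ, ∀ n : ℕ, n ≤ L.len g → ∃ x, L.len x = n ∧ L.len (x⁻¹ * g) + n = L.len g)
    (N : Subgroup Γ) (hinf : (N : Set Γ).Infinite) : ∃ x, ∃ g ∈ N, (L.conj x).Lox g := by
  by_contra hcon
  push Not at hcon
  have hN : ∀ x : Γ, ∀ g ∈ N, L.len (x⁻¹ * (g * g) * x) < L.len (x⁻¹ * g * x) + (2 * L.D + 1) := by
    intro x g hg
    by_contra h
    push Not at h
    exact hcon x g hg ((L.conj x).lox_of g h)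
  have hB := L.fin (200 * L.D + 300)
  obtain ⟨S, hS, hcard⟩ := hinf.exists_subset_card_eq (hB.toFinset.card + 1)
  obtain ⟨x, hx⟩ := L.serre geod N hN S (fun s hs => hS hs)
  have := Finset.card_le_card_of_injOn (s := S) (t := hB.toFinset) (fun s => x⁻¹ * s * x)
    (fun s hs => by simpa using hx s hs) (fun a _ b _ h => by simpa using h)
  omega

end HypLen


namespace HypLen

variable {Γ : Type*} [Group Γ] (L : HypLen Γ)

variable {L} in
lemma Lox.inv {g : Γ} (hg : L.Lox g) : L.Lox g⁻¹ := by
  obtain ⟨C, h1, h2⟩ := hg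
  refine ⟨C, fun n => by rw [inv_pow, L.len_inv]; exact h1 n, fun m n => ?_⟩
  rw [gp_comm, inv_pow, inv_pow, inv_inv]; exact h2 n m

variable {L} in
lemma Lox.pow {g : Γ} (hg : L.Lox g) {k : ℕ} (hk : 0 < k) : L.Lox (g ^ k) := by
  obtain ⟨C, h1, h2⟩ := hg
  refine ⟨C, fun n => ?_, fun m n => ?_⟩
  · rw [← pow_mul]; have := h1 (k * n); nlinarith
  · rw [← pow_mul, ← pow_mul]; exact h2 _ _

variable {L} in
lemma Lox.zpow_eq_one {g : Γ} (hg : L.Lox g) {n : ℤ} (h : g ^ n = 1) : n = 0 := by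
  obtain ⟨C, h1, h2⟩ := hg
  have : g ^ n.natAbs = 1 := by
    rcases Int.natAbs_eq n with e | e
    · rw [e, zpow_natCast] at h; exact h
    · rw [e, zpow_neg, zpow_natCast, inv_eq_one] at h; exact h
  have h3 := h1 n.natAbs
  rw [this, L.len_one] at h3
  omega

variable {L} in
lemma Lox.zpow_inj {g : Γ} (hg : L.Lox g) {m n : ℤ} (h : g ^ m = g ^ n) : m = n := by
  have := hg.zpow_eq_one (n := m - n) (by rw [zpow_sub, h, mul_inv_cancel])
  omega

lemma len_zpow_ge {g : Γ} (h : ∀ n : ℕ, n ≤ L.len (g ^ n)) (n : ℤ) : n.natAbs ≤ L.len (g ^ n) := by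
  have h1 := h n.natAbs
  rcases Int.natAbs_eq n with e | e
  · conv_rhs => rw [e, zpow_natCast]
    exact h1
  · conv_rhs => rw [e, zpow_neg, zpow_natCast, L.len_inv]
    exact h1

variable {L} in
/-- elements commuting with `g` are close to the powers of `g` -/
lemma Lox.near_of_commute {g : Γ} (hg : L.Lox g) :
    ∃ B : ℕ, ∀ h : Γ, Commute h g → ∃ j : ℤ, L.len (h⁻¹ * g ^ j) ≤ B := by
  obtain ⟨C, h1, h2⟩ := hg
  refine ⟨L.len g + (C + 2 * L.D) + C + L.D, fun h hc => ?_⟩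
  set n := L.len h + C + 2 * L.D + 1 with hn
  have a1 : L.gp h (h * (g ^ n)⁻¹) (h * g ^ n) ≤ C := by
    have := L.gp_left h 1 (g ^ n)⁻¹ (g ^ n)
    rw [mul_one] at this
    rw [this]; exact h2 n n
  have a2 := L.gp_ge h (h * (g ^ n)⁻¹) ((g ^ n)⁻¹)
  have a3 := L.gp_ge h (h * g ^ n) (g ^ n)
  have c1 : h * g ^ n = g ^ n * h := hc.pow_right n
  have c2 : h * (g ^ n)⁻¹ = (g ^ n)⁻¹ * h := (hc.pow_right n).inv_right
  have e1 : L.d (h * g ^ n) (g ^ n) = L.len h := by rw [c1, d_comm, d_right]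
  have e2 : L.d (h * (g ^ n)⁻¹) (g ^ n)⁻¹ = L.len h := by rw [c2, d_comm, d_right]
  rw [e2, d_right, L.len_inv] at a2
  rw [e1, d_right] at a3
  have hl := h1 n
  have b1 := L.gp_hyp h (h * (g ^ n)⁻¹) (g ^ n)⁻¹ (h * g ^ n)
  have b2 := L.gp_hyp h (g ^ n)⁻¹ (g ^ n) (h * g ^ n)
  rw [L.gp_comm h (g ^ n) (h * g ^ n)] at b2
  have hK : L.gp h (g ^ n)⁻¹ ((g ^ n)⁻¹ * g ^ (n + n)) ≤ (C + 2 * L.D : ℕ) := by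
    rw [pow_add g n n, inv_mul_cancel_left]; push_cast; omega
  obtain ⟨j, _, hj⟩ := L.near g C h2 (g ^ n)⁻¹ h (n + n) _ hK
  refine ⟨-(n : ℤ) + j, ?_⟩
  rw [zpow_add, zpow_neg, zpow_natCast, zpow_natCast]
  exact hj

variable {L} in
lemma Lox.pow_eq_of_commute {g : Γ} (hg : L.Lox g) {e : Γ} {k : ℕ} (hk : 0 < k)
    (he : Commute e (g ^ k)) : ∃ a : ℕ, 0 < a ∧ ∃ b : ℤ, e ^ a = g ^ b := by
  obtain ⟨B, hB⟩ := (hg.pow hk).near_of_commute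
  choose j hj using fun i : ℕ => hB (e ^ i) (he.pow_left i)
  have : Finite {x | L.len x ≤ B} := L.fin B
  obtain ⟨i, i', hne, heq⟩ := Finite.exists_ne_map_eq_of_infinite
    (fun i : ℕ => (⟨(e ^ i)⁻¹ * (g ^ k) ^ (j i), hj i⟩ : {x | L.len x ≤ B}))
  have key : ∀ i i' : ℕ, i < i' → (e ^ i)⁻¹ * (g ^ k) ^ (j i) = (e ^ i')⁻¹ * (g ^ k) ^ (j i') →
      ∃ a : ℕ, 0 < a ∧ ∃ b : ℤ, e ^ a = g ^ b := by
    intro i i' hlt h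
    refine ⟨i' - i, by omega, k * (j i' - j i), ?_⟩
    have e1 : e ^ i' = e ^ (i' - i) * e ^ i := by rw [← pow_add]; congr 1; omega
    rw [e1, mul_inv_rev] at h
    have e2 : e ^ (i' - i) = e ^ i * (e ^ (i' - i)) * (e ^ i)⁻¹ := by
      rw [← pow_add, add_comm, pow_add, mul_inv_cancel_right]
    have h' : e ^ i * (e ^ i)⁻¹ * ((g ^ k) ^ j i) = (e ^ (i' - i))⁻¹ * (g ^ k) ^ j i' := by
      rw [mul_assoc, h]
      have : e ^ i * ((e ^ i)⁻¹ * (e ^ (i' - i))⁻¹ * (g ^ k) ^ j i') = (e ^ (i' - i))⁻¹ * (g ^ k) ^ j i' := by group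
      exact this
    rw [mul_inv_cancel, one_mul, eq_inv_mul_iff_mul_eq, ← eq_mul_inv_iff_mul_eq] at h'
    rw [h', zpow_mul, zpow_natCast, zpow_sub]
  have heq' : (e ^ i)⁻¹ * (g ^ k) ^ (j i) = (e ^ i')⁻¹ * (g ^ k) ^ (j i') := congrArg Subtype.val heq
  rcases lt_or_gt_of_ne hne with h | h
  · exact key i i' h heq'
  · exact key i' i h heq'.symm

variable {L} in
lemma Lox.natAbs_le {g : Γ} (hg : L.Lox g) {h : Γ} {p q : ℤ}
    (hh : h * g ^ p * h⁻¹ = g ^ q) : q.natAbs ≤ p.natAbs := by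
  obtain ⟨C, h1, h2⟩ := hg
  by_contra hlt
  push Not at hlt
  have habs : ∀ n : ℤ, L.len (g ^ n) = L.len (g ^ n.natAbs) := by
    intro n
    rcases Int.natAbs_eq n with e | e
    · conv_lhs => rw [e, zpow_natCast]
    · conv_lhs => rw [e, zpow_neg, zpow_natCast, L.len_inv]
  set n := C + 2 * L.len h + 1 with hn
  have e1 : h * g ^ (p * n) * h⁻¹ = g ^ (q * n) := by
    rw [zpow_mul, zpow_mul, ← hh, zpow_natCast, zpow_natCast, conj_pow]
  have e2 : L.len (g ^ (q * n)) ≤ L.len (g ^ (p * n)) + 2 * L.len h := by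
    rw [← e1]
    have a := L.len_mul (h * g ^ (p * n)) h⁻¹
    have b := L.len_mul h (g ^ (p * n))
    rw [L.len_inv] at a
    omega
  rw [habs, habs (p * n), Int.natAbs_mul, Int.natAbs_mul, Int.natAbs_natCast] at e2
  have e3 := h2 (p.natAbs * n) (q.natAbs * n - p.natAbs * n)
  have hle : p.natAbs * n ≤ q.natAbs * n := Nat.mul_le_mul_right _ hlt.le
  have e4 : L.d (g ^ (p.natAbs * n))⁻¹ (g ^ (q.natAbs * n - p.natAbs * n)) =
      L.len (g ^ (q.natAbs * n)) := by
    unfold d; rw [inv_inv, ← pow_add]; congr 2; omega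
  unfold gp at e3
  rw [e4, d_one, d_one, L.len_inv] at e3
  have e5 := h1 (q.natAbs * n - p.natAbs * n)
  have e6 : p.natAbs * n + n ≤ q.natAbs * n := by
    have : (p.natAbs + 1) * n ≤ q.natAbs * n := Nat.mul_le_mul_right _ hlt
    linarith
  omega

variable {L} in
lemma Lox.commute_of_conj {g : Γ} (hg : L.Lox g) (htf : ∀ x : Γ, x ≠ 1 → ¬ IsOfFinOrder x)
    {h : Γ} {p q : ℤ} (hp : p ≠ 0) (hh : h * g ^ p * h⁻¹ = g ^ q) :
    ∃ k : ℕ, 0 < k ∧ Commute h (g ^ k) := by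
  have l1 := hg.natAbs_le hh
  have l2 := hg.natAbs_le (h := h⁻¹) (p := q) (q := p) (by rw [← hh]; group)
  have hpq : q = p ∨ q = -p := by omega
  rcases hpq with rfl | rfl
  · refine ⟨q.natAbs, by omega, ?_⟩
    have hc : Commute h (g ^ q) := by
      rw [mul_inv_eq_iff_eq_mul] at hh; exact hh
    rcases Int.natAbs_eq q with e | e
    · rw [e, zpow_natCast] at hc; exact hc
    · rw [e, zpow_neg, zpow_natCast] at hc; simpa using hc.inv_right
  · exfalso
    have hc2 : Commute (h ^ 2) (g ^ p) := by
      have a : h * g ^ (-p) * h⁻¹ = g ^ p := by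
        rw [zpow_neg, ← conj_inv, hh, zpow_neg, inv_inv]
      have b : h ^ 2 * g ^ p * (h ^ 2)⁻¹ = g ^ p := by
        rw [pow_two]
        calc _ = h * (h * g ^ p * h⁻¹) * h⁻¹ := by group
          _ = _ := by rw [hh, a]
      rw [mul_inv_eq_iff_eq_mul] at b; exact b
    have hc3 : Commute (h ^ 2) (g ^ p.natAbs) := by
      rcases Int.natAbs_eq p with e | e
      · rw [e, zpow_natCast] at hc2; exact hc2
      · rw [e, zpow_neg, zpow_natCast] at hc2; simpa using hc2.inv_right
    obtain ⟨a, ha, b, hb⟩ := hg.pow_eq_of_commute (by omega) hc3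
    have c1 : h * g ^ b * h⁻¹ = g ^ b := by
      rw [← hb]; group
    have c2 : h * g ^ (p * b) * h⁻¹ = g ^ (-p * b) := by
      rw [zpow_mul, zpow_mul, ← hh, conj_zpow]
    have c3 : h * g ^ (p * b) * h⁻¹ = g ^ (p * b) := by
      rw [mul_comm p b, zpow_mul, ← conj_zpow, c1]
    have c4 := hg.zpow_inj (c2.symm.trans c3)
    have c5 : b = 0 := by
      have : p * b = 0 := by linarith
      rcases mul_eq_zero.mp this with h0 | h0
      · exact absurd h0 hp
      · exact h0
    rw [c5, zpow_zero, ← pow_mul] at hb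
    have h1 : h = 1 := by
      by_contra hne
      exact htf h hne (isOfFinOrder_iff_pow_eq_one.mpr ⟨2 * a, by omega, hb⟩)
    rw [h1] at hh
    have := hg.zpow_inj (m := p) (n := -p) (by simpa using hh)
    omega

/-- fellow travelling implies commensurability -/
lemma commens_aux {u v h : Γ} (hu : L.Lox u) (hv : L.Lox v)
    (hunb : ∀ T : ℕ, ∃ n m : ℕ, (T : ℤ) < L.gp 1 (u ^ n) (h * v ^ m)) :
    ∃ p q : ℤ, p ≠ 0 ∧ u ^ p = h * v ^ q * h⁻¹ := by
  obtain ⟨C, h1, h2⟩ := hu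
  obtain ⟨C', h1', h2'⟩ := hv
  set B := L.len v + (C + 2 * L.D) + C' + L.D with hB
  set F := (L.fin B).toFinset with hF
  set i0 := L.len h + C + 2 * L.D + 1 with hi0
  set M := i0 + F.card with hM
  obtain ⟨n, m, hnm⟩ := hunb (2 * (M * L.len u) + C + 2 * L.D)
  have hMn : M ≤ n := by
    by_contra hlt
    have a := L.gp_le 1 (u ^ n) (h * v ^ m)
    rw [d_one] at a
    have b := L.len_pow_le u n
    have c : n * L.len u ≤ M * L.len u := Nat.mul_le_mul_right _ (by omega)
    push_cast at hnm
    have c' : ((n * L.len u : ℕ) : ℤ) ≤ (M * L.len u : ℕ) := by exact_mod_cast c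
    push_cast at c'
    omega
  have hclose : ∀ i : ℕ, i0 ≤ i → i ≤ M → ∃ j : ℕ, L.d (u ^ i) (h * v ^ j) ≤ B := by
    intro i hi hi'
    have a1 : L.gp (u ^ i) 1 (u ^ n) ≤ C := by
      have e1 := L.gp_left (u ^ i) 1 (u ^ i)⁻¹ (u ^ (n - i))
      rw [mul_one, mul_inv_cancel, ← pow_add] at e1
      have e2 : i + (n - i) = n := by omega
      rw [e2] at e1
      rw [e1]; exact h2 _ _
    have li : L.len (u ^ i) ≤ M * L.len u :=
      (L.len_pow_le u i).trans (Nat.mul_le_mul_right _ hi')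
    have li' : ((L.len (u ^ i) : ℕ) : ℤ) ≤ M * L.len u := by exact_mod_cast li
    have a2 := L.gp_base 1 (u ^ i) (u ^ n) (h * v ^ m)
    rw [d_one, L.gp_comm (u ^ i)] at a2
    have a3 := L.gp_hyp (u ^ i) 1 (h * v ^ m) (u ^ n)
    have a4 := L.gp_ge (u ^ i) 1 h
    rw [d_one', d_one] at a4
    have a5 := L.gp_hyp (u ^ i) 1 h (h * v ^ m)
    have a6 := h1 i
    push_cast at hnm
    exact (L.near v C' h2' h (u ^ i) m (C + 2 * L.D) (by push_cast; omega)).imp fun j hj => hj.2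
  have hj : ∀ i : ℕ, ∃ j : ℕ, i0 ≤ i → i ≤ M → L.d (u ^ i) (h * v ^ j) ≤ B := by
    intro i
    by_cases hi : i0 ≤ i ∧ i ≤ M
    · obtain ⟨j, hj⟩ := hclose i hi.1 hi.2
      exact ⟨j, fun _ _ => hj⟩
    · exact ⟨0, fun a b => absurd ⟨a, b⟩ hi⟩
  choose j hj using hj
  obtain ⟨i, hi, i', hi', hne, heq⟩ := Finset.exists_ne_map_eq_of_card_lt_of_maps_to
    (s := Finset.Icc i0 M) (t := F) (f := fun i => (u ^ i)⁻¹ * (h * v ^ j i))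
    (by rw [Nat.card_Icc]; omega)
    (by
      intro i hi
      rw [Finset.coe_Icc, Set.mem_Icc] at hi
      have := hj i hi.1 hi.2
      simpa [hF, d] using this)
  refine ⟨(i : ℤ) - i', (j i : ℤ) - j i', by omega, ?_⟩
  rw [inv_mul_eq_iff_eq_mul] at heq
  have e : u ^ (i : ℤ) * (u ^ (i' : ℤ))⁻¹ = h * v ^ (j i : ℤ) * (v ^ (j i' : ℤ))⁻¹ * h⁻¹ := by
    simp only [zpow_natCast]
    rw [heq]; group
  rw [zpow_sub, zpow_sub, e]; group

variable {L} in
lemma Lox.bounded {g : Γ} (hg : L.Lox g) (htf : ∀ x : Γ, x ≠ 1 → ¬ IsOfFinOrder x) {h : Γ}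
    (hh : ∀ k : ℕ, 0 < k → ¬ Commute h (g ^ k)) :
    ∃ C : ℕ, ∀ n m : ℤ, L.gp 1 (g ^ n) (h * g ^ m) ≤ C := by
  have main : ∀ u v : Γ, (u = g ∨ u = g⁻¹) → (v = g ∨ v = g⁻¹) →
      ∃ C : ℕ, ∀ n m : ℕ, L.gp 1 (u ^ n) (h * v ^ m) ≤ C := by
    intro u v hu hv
    by_contra hcon
    push Not at hcon
    have hu' : L.Lox u := by rcases hu with rfl | rfl; exacts [hg, hg.inv]
    have hv' : L.Lox v := by rcases hv with rfl | rfl; exacts [hg, hg.inv]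
    obtain ⟨p, q, hp, hpq⟩ := L.commens_aux hu' hv' hcon
    have hu2 : ∃ p' : ℤ, p' ≠ 0 ∧ u ^ p = g ^ p' := by
      rcases hu with rfl | rfl
      · exact ⟨p, hp, rfl⟩
      · exact ⟨-p, by omega, by simp⟩
    have hv2 : ∃ q' : ℤ, v ^ q = g ^ q' := by
      rcases hv with rfl | rfl
      · exact ⟨q, rfl⟩
      · exact ⟨-q, by simp⟩
    obtain ⟨p', hp', ep⟩ := hu2
    obtain ⟨q', eq⟩ := hv2
    rw [ep, eq] at hpq
    have hq' : q' ≠ 0 := by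
      rintro rfl
      have := hg.zpow_eq_one (n := p') (by rw [hpq]; simp)
      exact hp' this
    obtain ⟨k, hk, hc⟩ := hg.commute_of_conj htf hq' hpq.symm
    exact hh k hk hc
  obtain ⟨C1, hC1⟩ := main g g (.inl rfl) (.inl rfl)
  obtain ⟨C2, hC2⟩ := main g g⁻¹ (.inl rfl) (.inr rfl)
  obtain ⟨C3, hC3⟩ := main g⁻¹ g (.inr rfl) (.inl rfl)
  obtain ⟨C4, hC4⟩ := main g⁻¹ g⁻¹ (.inr rfl) (.inr rfl)
  refine ⟨C1 + C2 + C3 + C4, fun n m => ?_⟩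
  push_cast
  have r : ∀ n : ℤ, g ^ n = g ^ n.natAbs ∨ g ^ n = g⁻¹ ^ n.natAbs := by
    intro n
    rcases Int.natAbs_eq n with e | e
    · left; conv_lhs => rw [e, zpow_natCast]
    · right; conv_lhs => rw [e, zpow_neg, zpow_natCast, ← inv_pow]
  rcases r n with e | e <;> rcases r m with e' | e' <;> rw [e, e']
  · have := hC1 n.natAbs m.natAbs; omega
  · have := hC2 n.natAbs m.natAbs; omega
  · have := hC3 n.natAbs m.natAbs; omega
  · have := hC4 n.natAbs m.natAbs; omega

/-- the elementary closure of `g` -/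
def elem (g : Γ) : Subgroup Γ where
  carrier := {h | ∃ k : ℕ, 0 < k ∧ Commute h (g ^ k)}
  one_mem' := ⟨1, one_pos, Commute.one_left _⟩
  inv_mem' := by
    rintro h ⟨k, hk, hc⟩
    exact ⟨k, hk, hc.inv_left⟩
  mul_mem' := by
    rintro a b ⟨k, hk, hc⟩ ⟨l, hl, hc'⟩
    refine ⟨k * l, Nat.mul_pos hk hl, Commute.mul_left ?_ ?_⟩
    · rw [pow_mul]; exact hc.pow_right l
    · rw [mul_comm, pow_mul]; exact hc'.pow_right k

variable {L} in
lemma Lox.bounded' {g : Γ} (hg : L.Lox g) (htf : ∀ x : Γ, x ≠ 1 → ¬ IsOfFinOrder x) {a b : Γ}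
    (hh : a⁻¹ * b ∉ elem g) :
    ∃ C : ℕ, ∀ n m : ℤ, L.gp 1 (a * g ^ n) (b * g ^ m) ≤ C := by
  obtain ⟨C, hC⟩ := hg.bounded htf (h := a⁻¹ * b) (fun k hk hc => hh ⟨k, hk, hc⟩)
  refine ⟨C + 2 * L.len a, fun n m => ?_⟩
  have h1 := L.gp_left a a⁻¹ (g ^ n) (a⁻¹ * b * g ^ m)
  have h2 := L.gp_base a⁻¹ 1 (g ^ n) (a⁻¹ * b * g ^ m)
  rw [d_one', L.len_inv] at h2
  rw [mul_inv_cancel, mul_assoc a⁻¹, mul_inv_cancel_left] at h1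
  rw [h1]
  rw [mul_assoc] at h2
  have := hC n m
  rw [mul_assoc] at this
  push_cast
  omega

variable {L} in
lemma Lox.infinite_quotient {g : Γ} (hg : L.Lox g) (htf : ∀ x : Γ, x ≠ 1 → ¬ IsOfFinOrder x)
    (hE : elem g ≠ ⊤) : Infinite (Γ ⧸ elem g) := by
  by_contra hfin
  rw [not_infinite_iff_finite] at hfin
  obtain ⟨h0, hh0⟩ : ∃ h0, h0 ∉ elem g := by
    by_contra hcon
    push Not at hcon
    exact hE (eq_top_iff.mpr fun x _ => hcon x)
  obtain ⟨k, hk, -, l, hl, hc⟩ := Subgroup.exists_pow_mem_of_index_ne_zero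
    (H := elem g) (Subgroup.index_ne_zero_of_finite) (h0 * g * h0⁻¹)
  obtain ⟨a, ha, b, hb⟩ := hg.pow_eq_of_commute hl hc
  rw [← pow_mul, conj_pow] at hb
  obtain ⟨k', hk', hc'⟩ := hg.commute_of_conj htf (h := h0) (p := (k * a : ℕ)) (q := b)
    (by have := Nat.mul_pos hk ha; omega) (by rw [zpow_natCast]; exact hb)
  exact hh0 ⟨k', hk', hc'⟩

end HypLen


namespace HypLen

variable {Γ : Type*} [Group Γ] (L : HypLen Γ)

/-- reduced words in the letters `Λ`, together with their last letter -/
inductive Red (Λ : Set Γ) : Γ → Γ → Prop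
  | single (s : Γ) (hs : s ∈ Λ) : Red Λ s s
  | snoc (w t s : Γ) (h : Red Λ w t) (hs : s ∈ Λ) (hne : s ≠ t⁻¹) : Red Λ (w * s) s

lemma Red.mem {Λ : Set Γ} {w t : Γ} (h : Red Λ w t) : t ∈ Λ := by
  cases h <;> assumption

lemma red_of_closure (Λ : Set Γ) (w : Γ) (hw : w ∈ Subgroup.closure Λ)
    (hinv : ∀ s ∈ Λ, s⁻¹ ∈ Λ) : w = 1 ∨ ∃ t, Red Λ w t := by
  have step : ∀ x, (x = 1 ∨ ∃ t, Red Λ x t) → ∀ s ∈ Λ, (x * s = 1 ∨ ∃ t, Red Λ (x * s) t) := by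
    rintro x (rfl | ⟨t, ht⟩) s hs
    · right; exact ⟨s, by rw [one_mul]; exact .single s hs⟩
    · by_cases hst : s = t⁻¹
      · subst hst
        cases ht with
        | single _ hs => left; simp
        | snoc w t' _ h hs hne =>
          right; exact ⟨t', by rw [mul_inv_cancel_right]; exact h⟩
      · right; exact ⟨s, .snoc _ _ _ ht hs hst⟩
  induction hw using Subgroup.closure_induction_right with
  | one => left; rfl
  | mul_right x hx y hy ih => exact step x ih y hy
  | mul_inv_cancel x hx y hy ih => exact step x ih _ (hinv y hy)

lemma red_len {Λ : Set Γ}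
    (h1 : ∀ s ∈ Λ, 1 ≤ L.len s)
    (h2 : ∀ s ∈ Λ, ∀ t ∈ Λ, s ≠ t → L.len s + (L.D + 1) ≤ L.d s t ∧ L.len t + (L.D + 1) ≤ L.d s t)
    (hinv : ∀ s ∈ Λ, s⁻¹ ∈ Λ) {w t : Γ} (hw : Red Λ w t) :
    L.len (w * t⁻¹) + 1 ≤ L.len w := by
  induction hw with
  | single s hs => have := h1 s hs; rw [mul_inv_cancel, L.len_one]; omega
  | snoc w t s h hs hne ih =>
    rw [mul_inv_cancel_right]
    have ht := h.mem
    have := h2 _ (hinv t ht) s hs (Ne.symm hne)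
    unfold d at this
    rw [inv_inv, L.len_inv] at this
    have := L.step (w * t⁻¹) t s 1 (by simpa using ih) this.1 this.2
    simpa using this

lemma schottky {ι : Type*} (lam : ι → Bool → Γ) (hl : ∀ i b, lam i (!b) = (lam i b)⁻¹)
    (h1 : ∀ i b, 1 ≤ L.len (lam i b))
    (h2 : ∀ i b j c, (i, b) ≠ (j, c) → L.len (lam i b) + (L.D + 1) ≤ L.d (lam i b) (lam j c) ∧
      L.len (lam j c) + (L.D + 1) ≤ L.d (lam i b) (lam j c))
    (i0 : ι) : lam i0 true ∉ Subgroup.closure {x | ∃ i, i ≠ i0 ∧ x = lam i true} := by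
  intro hmem
  set Λ : Set Γ := {x | ∃ i b, x = lam i b} with hΛ
  set Λ' : Set Γ := {x | ∃ i b, i ≠ i0 ∧ x = lam i b} with hΛ'
  have hinv : ∀ s ∈ Λ, s⁻¹ ∈ Λ := by
    rintro _ ⟨i, b, rfl⟩; exact ⟨i, !b, (hl i b).symm⟩
  have hinv' : ∀ s ∈ Λ', s⁻¹ ∈ Λ' := by
    rintro _ ⟨i, b, hi, rfl⟩; exact ⟨i, !b, hi, (hl i b).symm⟩
  have hsub : Λ' ⊆ Λ := by rintro _ ⟨i, b, hi, rfl⟩; exact ⟨i, b, rfl⟩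
  have hmono : ∀ {w t}, Red Λ' w t → Red Λ w t := by
    intro w t h
    induction h with
    | single s hs => exact .single s (hsub hs)
    | snoc w t s h hs hne ih => exact .snoc w t s ih (hsub hs) hne
  have hH1 : ∀ s ∈ Λ, 1 ≤ L.len s := by rintro _ ⟨i, b, rfl⟩; exact h1 i b
  have hH2 : ∀ s ∈ Λ, ∀ t ∈ Λ, s ≠ t →
      L.len s + (L.D + 1) ≤ L.d s t ∧ L.len t + (L.D + 1) ≤ L.d s t := by
    rintro _ ⟨i, b, rfl⟩ _ ⟨j, c, rfl⟩ hne
    refine h2 i b j c ?_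
    intro h
    rw [Prod.mk.injEq] at h
    exact hne (by rw [h.1, h.2])
  have hcl : lam i0 true ∈ Subgroup.closure Λ' := by
    refine Subgroup.closure_mono ?_ hmem
    rintro _ ⟨i, hi, rfl⟩; exact ⟨i, true, hi, rfl⟩
  rcases red_of_closure Λ' _ hcl hinv' with h | ⟨t, ht⟩
  · have := h1 i0 true
    rw [h, L.len_one] at this
    omega
  · have htm : t ∈ Λ' := ht.mem
    have hne : (lam i0 true)⁻¹ ≠ t⁻¹ := by
      obtain ⟨i, b, hi, rfl⟩ := htm
      intro h
      rw [inv_inj] at h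
      have := (h2 i0 true i b (by
        intro h'
        rw [Prod.mk.injEq] at h'
        exact hi h'.1.symm)).1
      rw [h, d_self] at this
      omega
    have hred := Red.snoc (lam i0 true) t (lam i0 true)⁻¹ (hmono ht)
      (hinv _ ⟨i0, true, rfl⟩) hne
    have := L.red_len hH1 hH2 hinv hred
    rw [mul_inv_cancel, L.len_one] at this
    omega

/-- from diverging halves to Schottky letters -/
lemma schottky' {ι : Type*} (p q : ι → Γ) (C : ℕ)
    (hp : ∀ i, 4 * C + 10 * L.D + 10 ≤ L.len (p i)) (hq : ∀ i, 4 * C + 10 * L.D + 10 ≤ L.len (q i))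
    (hpp : ∀ i j, i ≠ j → L.gp 1 (p i) (p j) ≤ C) (hqq : ∀ i j, i ≠ j → L.gp 1 (q i) (q j) ≤ C)
    (hpq : ∀ i j, L.gp 1 (p i) (q j) ≤ C)
    (hm : ∀ i, L.gp 1 (p i)⁻¹ (q i)⁻¹ ≤ C) (i0 : ι) :
    p i0 * (q i0)⁻¹ ∉ Subgroup.closure {x | ∃ i, i ≠ i0 ∧ x = p i * (q i)⁻¹} := by
  let v : ι → Bool → Γ := fun i b => if b then p i else q i
  let lam : ι → Bool → Γ := fun i b => if b then p i * (q i)⁻¹ else q i * (p i)⁻¹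
  have hv : ∀ i b, 4 * C + 10 * L.D + 10 ≤ L.len (v i b) := by
    intro i b; cases b; exacts [hq i, hp i]
  have hvv : ∀ i b j c, (i, b) ≠ (j, c) → L.gp 1 (v i b) (v j c) ≤ C := by
    intro i b j c hne
    cases b <;> cases c
    · exact hqq i j (fun h => hne (by rw [h]))
    · change L.gp 1 (q i) (p j) ≤ C
      rw [gp_comm]; exact hpq j i
    · exact hpq i j
    · exact hpp i j (fun h => hne (by rw [h]))
  have hlen : ∀ i b, L.len (p i) + L.len (q i) ≤ L.len (lam i b) + C := by
    intro i b
    have h := hm i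
    unfold gp at h
    rw [d_one, d_one, L.len_inv, L.len_inv] at h
    unfold d at h
    rw [inv_inv] at h
    have e : L.len (lam i b) = L.len (p i * (q i)⁻¹) := by
      cases b
      · change L.len (q i * (p i)⁻¹) = _
        rw [← L.len_inv]; congr 1; group
      · rfl
    omega
  have hlv : ∀ i b, 2 * (L.len (v i b) : ℤ) - C ≤ L.gp 1 (v i b) (lam i b) := by
    intro i b
    have h := hlen i b
    have h2 : L.d (v i b) (lam i b) + L.len (v i b) = L.len (p i) + L.len (q i) := by
      cases b
      · change L.d (q i) (q i * (p i)⁻¹) + L.len (q i) = _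
        rw [d_right, L.len_inv]
      · change L.d (p i) (p i * (q i)⁻¹) + L.len (p i) = _
        rw [d_right, L.len_inv]; omega
    unfold gp
    rw [d_one, d_one]
    omega
  refine L.schottky lam ?_ ?_ ?_ i0
  · intro i b; cases b <;> simp [lam]
  · intro i b
    have := hlen i b
    have := hp i
    omega
  · intro i b j c hne
    have a1 := hvv i b j c hne
    have a2 := hlv i b
    have a3 := hlv j c
    have a4 := hv i b
    have a5 := hv j c
    have b1 := L.gp_hyp 1 (v i b) (lam i b) (v j c)
    have b2 := L.gp_hyp 1 (lam i b) (lam j c) (v j c)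
    rw [L.gp_comm 1 (lam j c)] at b2
    have l1 := hlen i b
    have l2 := hlen j c
    have := hp i
    have := hp j
    have key : L.gp 1 (lam i b) (lam j c) ≤ C + 2 * L.D := by omega
    unfold gp at key
    rw [d_one, d_one] at key
    have := hq i
    have := hq j
    omega

lemma exists_bound {ι : Type*} [Finite ι] {P : ι → ℕ → Prop} (hmono : ∀ i m n, m ≤ n → P i m → P i n)
    (h : ∀ i, ∃ n, P i n) : ∃ n, ∀ i, P i n := by
  choose f hf using h
  obtain ⟨n, hn⟩ := (Set.finite_range f).bddAbove
  exact ⟨n, fun i => hmono i _ _ (hn ⟨i, rfl⟩) (hf i)⟩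

variable {L} in
lemma Lox.construct {g : Γ} (hg : L.Lox g) (htf : ∀ x : Γ, x ≠ 1 → ¬ IsOfFinOrder x)
    (hE : elem g ≠ ⊤) {ι : Type*} [Finite ι] (τ : ι → Γ) :
    ∃ f : ι → Γ, (∀ N : Subgroup Γ, N.Normal → g ∈ N → ∀ i, f i ∈ N) ∧
      ∀ i0, τ i0 * f i0 ∉ Subgroup.closure {x | ∃ i, i ≠ i0 ∧ x = τ i * f i} := by
  classical
  have hinf := hg.infinite_quotient htf hE
  obtain ⟨n, ⟨eι⟩⟩ := Finite.exists_equiv_fin ι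
  let γ' : ι → Γ ⧸ elem g := fun i => Infinite.natEmbedding (Γ ⧸ elem g) (eι i)
  have hγ' : Function.Injective γ' := by
    intro i j h
    exact eι.injective (Fin.val_injective ((Infinite.natEmbedding _).injective h))
  let γ : ι → Γ := fun i => (γ' i).out
  let α : ι → Γ := fun i => (τ i)⁻¹ * γ i
  let bad : Set (Γ ⧸ elem g) := Set.range γ' ∪ Set.range (fun i => (α i : Γ ⧸ elem g))
  have hbad : bad.Finite := (Set.finite_range _).union (Set.finite_range _)
  have hgood : Infinite ↥(badᶜ) := hbad.infinite_compl.to_subtype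
  let β' : ι → ↥(badᶜ) := fun i => Infinite.natEmbedding _ (eι i)
  have hβ' : Function.Injective β' := by
    intro i j h
    exact eι.injective (Fin.val_injective ((Infinite.natEmbedding _).injective h))
  let β : ι → Γ := fun i => (β' i).1.out
  have outγ : ∀ i, ((γ i : Γ) : Γ ⧸ elem g) = γ' i := fun i => Quotient.out_eq' _
  have outβ : ∀ i, ((β i : Γ) : Γ ⧸ elem g) = β' i := fun i => Quotient.out_eq' _
  have d1 : ∀ i j, i ≠ j → (γ i)⁻¹ * γ j ∉ elem g := by
    intro i j hij h
    rw [← QuotientGroup.eq, outγ, outγ] at h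
    exact hij (hγ' h)
  have d2 : ∀ i j, i ≠ j → (β i)⁻¹ * β j ∉ elem g := by
    intro i j hij h
    rw [← QuotientGroup.eq, outβ, outβ] at h
    exact hij (hβ' (Subtype.ext h))
  have d3 : ∀ i j, (γ i)⁻¹ * β j ∉ elem g := by
    intro i j h
    rw [← QuotientGroup.eq, outγ, outβ] at h
    exact (β' j).2 (Or.inl ⟨i, h⟩)
  have d4 : ∀ i j, (α i)⁻¹ * β j ∉ elem g := by
    intro i j h
    rw [← QuotientGroup.eq, outβ] at h
    exact (β' j).2 (Or.inr ⟨i, h⟩)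
  -- uniform constants
  have hmono : ∀ (Q : Prop) (a b : Γ) (m n : ℕ), m ≤ n →
      (Q → ∀ k l : ℤ, L.gp 1 (a * g ^ k) (b * g ^ l) ≤ m) →
      (Q → ∀ k l : ℤ, L.gp 1 (a * g ^ k) (b * g ^ l) ≤ n) := by
    intro Q a b m n hmn h hQ k l
    have := h hQ k l
    omega
  have hex : ∀ (Q : Prop) (a b : Γ), (Q → a⁻¹ * b ∉ elem g) →
      ∃ n : ℕ, (Q → ∀ k l : ℤ, L.gp 1 (a * g ^ k) (b * g ^ l) ≤ n) := by
    intro Q a b h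
    by_cases hQ : Q
    · obtain ⟨C, hC⟩ := hg.bounded' htf (h hQ)
      exact ⟨C, fun _ => hC⟩
    · exact ⟨0, fun h => absurd h hQ⟩
  obtain ⟨C1, hC1⟩ := exists_bound (ι := ι × ι) (fun x => hmono (x.1 ≠ x.2) (γ x.1) (γ x.2))
    (fun x => hex _ _ _ (d1 x.1 x.2))
  obtain ⟨C2, hC2⟩ := exists_bound (ι := ι × ι) (fun x => hmono (x.1 ≠ x.2) (β x.1) (β x.2))
    (fun x => hex _ _ _ (d2 x.1 x.2))
  obtain ⟨C3, hC3⟩ := exists_bound (ι := ι × ι) (fun x => hmono True (γ x.1) (β x.2))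
    (fun x => hex _ _ _ (fun _ => d3 x.1 x.2))
  obtain ⟨C4, hC4⟩ := exists_bound (ι := ι × ι) (fun x => hmono True (α x.1) (β x.2))
    (fun x => hex _ _ _ (fun _ => d4 x.1 x.2))
  obtain ⟨C5, hC5⟩ := exists_bound (ι := ι)
    (P := fun i n => L.len (α i) + L.len (β i) + L.len (γ i) ≤ n)
    (fun i m n hmn h => h.trans hmn) (fun i => ⟨_, le_rfl⟩)
  set C := C1 + C2 + C3 + C4 + 4 * C5 with hC
  obtain ⟨C0, hgrow, -⟩ := hg
  set M : ℕ := 5 * C + 10 * L.D + 10 with hM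
  let p : ι → Γ := fun i => γ i * g ^ (M : ℤ) * (α i)⁻¹
  let q : ι → Γ := fun i => β i * g ^ (-M : ℤ) * (β i)⁻¹
  -- replacing endpoints
  have rep : ∀ a b c e : Γ, L.gp 1 (a * c) (b * e) ≤ L.gp 1 a b + 2 * L.len c + 2 * L.len e := by
    intro a b c e
    have h1 := L.gp_pt 1 (a * c) a (b * e)
    have h2 := L.gp_pt 1 (b * e) b a
    rw [L.d_comm, d_right] at h1 h2
    rw [L.gp_comm 1 (b * e), L.gp_comm 1 b] at h2
    omega
  have hlen : ∀ (a b : Γ) (k : ℤ), k.natAbs ≤ L.len (a * g ^ k * b⁻¹) + L.len a + L.len b := by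
    intro a b k
    have h1 := L.len_zpow_ge hgrow k
    have h2 := L.len_mul (a⁻¹ * (a * g ^ k * b⁻¹)) b
    have h3 := L.len_mul a⁻¹ (a * g ^ k * b⁻¹)
    have e : a⁻¹ * (a * g ^ k * b⁻¹) * b = g ^ k := by group
    rw [e] at h2
    rw [L.len_inv] at h3
    omega
  refine ⟨fun i => α i * g ^ (M : ℤ) * (α i)⁻¹ * (β i * g ^ (M : ℤ) * (β i)⁻¹), ?_, ?_⟩
  · intro N hN hgN i
    exact N.mul_mem (hN.conj_mem _ (N.zpow_mem hgN _) _) (hN.conj_mem _ (N.zpow_mem hgN _) _)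
  · intro i0
    have e : ∀ i, τ i * (α i * g ^ (M : ℤ) * (α i)⁻¹ * (β i * g ^ (M : ℤ) * (β i)⁻¹)) =
        p i * (q i)⁻¹ := by
      intro i
      simp only [p, q, α]
      group
    simp only [e]
    refine L.schottky' p q C ?_ ?_ ?_ ?_ ?_ ?_ i0
    · intro i
      have := hlen (γ i) (α i) M
      have := hC5 i
      simp only [Int.natAbs_natCast] at *
      change _ ≤ L.len (γ i * g ^ (M : ℤ) * (α i)⁻¹)
      omega
    · intro i
      have := hlen (β i) (β i) (-M)
      have := hC5 i
      simp only [Int.natAbs_neg, Int.natAbs_natCast] at *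
      change _ ≤ L.len (β i * g ^ (-M : ℤ) * (β i)⁻¹)
      omega
    · intro i j hij
      have h1 := rep (γ i * g ^ (M : ℤ)) (γ j * g ^ (M : ℤ)) (α i)⁻¹ (α j)⁻¹
      have h2 := hC1 (i, j) hij M M
      dsimp only at h2
      have h3 := hC5 i
      have h4 := hC5 j
      rw [L.len_inv, L.len_inv] at h1
      simp only [p]
      omega
    · intro i j hij
      have h1 := rep (β i * g ^ (-M : ℤ)) (β j * g ^ (-M : ℤ)) (β i)⁻¹ (β j)⁻¹
      have h2 := hC2 (i, j) hij (-M) (-M)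
      dsimp only at h2
      have h3 := hC5 i
      have h4 := hC5 j
      rw [L.len_inv, L.len_inv] at h1
      simp only [q]
      omega
    · intro i j
      have h1 := rep (γ i * g ^ (M : ℤ)) (β j * g ^ (-M : ℤ)) (α i)⁻¹ (β j)⁻¹
      have h2 := hC3 (i, j) trivial M (-M)
      dsimp only at h2
      have h3 := hC5 i
      have h4 := hC5 j
      rw [L.len_inv, L.len_inv] at h1
      simp only [p, q]
      omega
    · intro i
      have h1 := rep (α i * g ^ (-M : ℤ)) (β i * g ^ (M : ℤ)) (γ i)⁻¹ (β i)⁻¹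
      have h2 := hC4 (i, i) trivial (-M) M
      dsimp only at h2
      have h3 := hC5 i
      rw [L.len_inv, L.len_inv] at h1
      have e1 : (p i)⁻¹ = α i * g ^ (-M : ℤ) * (γ i)⁻¹ := by simp only [p]; group
      have e2 : (q i)⁻¹ = β i * g ^ (M : ℤ) * (β i)⁻¹ := by simp only [q]; group
      rw [e1, e2]
      omega

end HypLen


lemma isCoatomic_subgroup_of_fg {Γ : Type*} [Group Γ] (hfg : Group.FG Γ) :
    IsCoatomic (Subgroup Γ) := by
  classical
  apply CompleteLattice.coatomic_of_top_compact
  rw [CompleteLattice.isCompactElement_iff_le_of_directed_sSup_le]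
  intro K hne hdir htop
  obtain ⟨S, hS⟩ := Group.fg_def.mp hfg
  have : ∀ T : Finset Γ, ∃ x ∈ K, (T : Set Γ) ⊆ x := by
    intro T
    induction T using Finset.induction_on with
    | empty => obtain ⟨x, hx⟩ := hne; exact ⟨x, hx, by simp⟩
    | insert a T _ ih =>
      obtain ⟨x, hx, hTx⟩ := ih
      obtain ⟨y, hy, hay⟩ := (Subgroup.mem_sSup_of_directedOn hne hdir).mp (htop (Subgroup.mem_top a))
      obtain ⟨z, hz, hxz, hyz⟩ := hdir x hx y hy
      refine ⟨z, hz, ?_⟩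
      rw [Finset.coe_insert]
      exact Set.insert_subset (hyz hay) (hTx.trans hxz)
  obtain ⟨x, hx, hSx⟩ := this S
  refine ⟨x, hx, ?_⟩
  rw [← hS]
  exact (Subgroup.closure_le _).mpr hSx

lemma frattini_comm {Γ : Type*} [CommGroup Γ] (hfg : Group.FG Γ)
    (htf : ∀ x : Γ, x ≠ 1 → ¬ IsOfFinOrder x) : frattini Γ = ⊥ := by
  rw [eq_bot_iff]
  intro x hx
  rw [Subgroup.mem_bot]
  by_contra hne
  have hfin : Module.Finite ℤ (Additive Γ) := by
    rw [Module.Finite.iff_addGroup_fg]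
    exact GroupFG.iff_add_fg.mp hfg
  have htor : Module.IsTorsionFree ℤ (Additive Γ) := by
    have : IsMulTorsionFree Γ := IsMulTorsionFree.of_not_isOfFinOrder (fun x hx => htf x hx)
    infer_instance
  have hfree : Module.Free ℤ (Additive Γ) := Module.free_of_finite_type_torsion_free'
  let b := Module.Free.chooseBasis ℤ (Additive Γ)
  have hx0 : b.repr (Additive.ofMul x) ≠ 0 := by
    intro h
    rw [LinearEquiv.map_eq_zero_iff] at h
    exact hne h
  obtain ⟨i, hi⟩ := Finsupp.ne_iff.mp hx0
  set m : ℤ := b.repr (Additive.ofMul x) i with hm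
  have hm0 : m ≠ 0 := hi
  obtain ⟨p, hpge, hp⟩ := Nat.exists_infinite_primes (m.natAbs + 1)
  have : Fact p.Prime := ⟨hp⟩
  let φ : Additive Γ →+ ZMod p := (Int.castAddHom (ZMod p)).comp (b.coord i).toAddMonoidHom
  have hsurj : Function.Surjective φ := by
    intro z
    obtain ⟨n, rfl⟩ := ZMod.intCast_surjective z
    exact ⟨n • b i, by simp [φ]⟩
  let ψ : Γ →* Multiplicative (ZMod p) := AddMonoidHom.toMultiplicativeRight φ
  have hψ : Function.Surjective ψ := hsurj
  have hcard : Nat.card (Multiplicative (ZMod p)) = p := by simp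
  have : IsSimpleGroup (Multiplicative (ZMod p)) := isSimpleGroup_of_prime_card hcard
  have hco : IsCoatom (⊥ : Subgroup (Multiplicative (ZMod p))) := by
    refine ⟨bot_ne_top, fun K hK => ?_⟩
    rcases (inferInstance : K.Normal).eq_bot_or_eq_top with h | h
    · exact absurd h hK.ne'
    · exact h
  have hle := frattini_le_coatom (Subgroup.isCoatom_comap_of_surjective hψ hco)
  have h1 := hle hx
  rw [Subgroup.mem_comap, Subgroup.mem_bot] at h1
  have h2 : ((m : ℤ) : ZMod p) = 0 := h1
  rw [ZMod.intCast_zmod_eq_zero_iff_dvd] at h2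
  have := Int.natAbs_dvd_natAbs.mpr h2
  have := Nat.le_of_dvd (by omega) this
  simp at this
  omega

namespace HypLen

variable {Γ : Type*} [Group Γ] {L : HypLen Γ}

lemma Lox.frattini_of_elem {g : Γ} (hg : L.Lox g) (hfg : Group.FG Γ)
    (htf : ∀ x : Γ, x ≠ 1 → ¬ IsOfFinOrder x) (hE : elem g = ⊤) : frattini Γ = ⊥ := by
  classical
  obtain ⟨S, hS⟩ := Group.fg_def.mp hfg
  have hmem : ∀ s : Γ, ∃ k : ℕ, 0 < k ∧ Commute s (g ^ k) := by
    intro s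
    have : s ∈ elem g := by rw [hE]; trivial
    exact this
  choose k hk hc using hmem
  set K := ∏ s ∈ S, k s with hK
  have hKpos : 0 < K := Finset.prod_pos fun s _ => hk s
  have hcent : g ^ K ∈ Subgroup.center Γ := by
    have hle : (⊤ : Subgroup Γ) ≤ Subgroup.centralizer {g ^ K} := by
      rw [← hS, Subgroup.closure_le]
      intro s hs
      obtain ⟨l, hl⟩ := Finset.dvd_prod_of_mem k hs
      have : Commute s (g ^ K) := by
        rw [hK, hl, pow_mul]; exact (hc s).pow_right l
      exact Subgroup.mem_centralizer_singleton_iff.mpr this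
    rw [Subgroup.mem_center_iff]
    intro x
    exact Subgroup.mem_centralizer_singleton_iff.mp (hle (Subgroup.mem_top x))
  obtain ⟨B, hB⟩ := (hg.pow hKpos).near_of_commute
  have hfinq : Finite (Γ ⧸ Subgroup.center Γ) := by
    have : Finite {x | L.len x ≤ B} := L.fin B
    refine Finite.of_surjective
      (fun x : {x | L.len x ≤ B} => ((x.1⁻¹ : Γ) : Γ ⧸ Subgroup.center Γ)) ?_
    intro y
    obtain ⟨h, rfl⟩ := QuotientGroup.mk_surjective y
    obtain ⟨j, hj⟩ := hB h (Subgroup.mem_center_iff.mp hcent h)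
    refine ⟨⟨h⁻¹ * (g ^ K) ^ j, hj⟩, ?_⟩
    rw [QuotientGroup.eq]
    have : ((h⁻¹ * (g ^ K) ^ j)⁻¹)⁻¹ * h = h⁻¹ * (g ^ K) ^ j * h⁻¹⁻¹ := by group
    rw [this]
    exact Subgroup.Normal.conj_mem inferInstance _ (Subgroup.zpow_mem _ hcent _) _
  have : (Subgroup.center Γ).FiniteIndex := Subgroup.finiteIndex_of_finite_quotient
  have hinj : Function.Injective (MonoidHom.transferCenterPow Γ) := by
    rw [injective_iff_map_eq_one]
    intro a ha
    by_contra hne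
    refine htf a hne (isOfFinOrder_iff_pow_eq_one.mpr
      ⟨(Subgroup.center Γ).index, Nat.pos_of_ne_zero Subgroup.FiniteIndex.index_ne_zero, ?_⟩)
    rw [← MonoidHom.transferCenterPow_apply, ha]; rfl
  have hcomm : ∀ a b : Γ, a * b = b * a := by
    intro a b
    apply hinj
    rw [map_mul, map_mul]
    exact Subtype.ext (Subgroup.mem_center_iff.mp (MonoidHom.transferCenterPow Γ b).2 _)
  exact @frattini_comm Γ { (inferInstance : Group Γ) with mul_comm := hcomm } hfg htf

lemma Lox.not_mem_frattini {g : Γ} (hg : L.Lox g) (hfg : Group.FG Γ)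
    (htf : ∀ x : Γ, x ≠ 1 → ¬ IsOfFinOrder x) (hE : elem g ≠ ⊤) : g ∉ frattini Γ := by
  classical
  intro hgF
  obtain ⟨S, hS⟩ := Group.fg_def.mp hfg
  obtain ⟨f, hf, hfree⟩ := hg.construct htf hE (ι := ↥(insert 1 S)) (fun i => i.1)
  have hfN : ∀ i, f i ∈ frattini Γ := hf (frattini Γ) inferInstance hgF
  let i0 : ↥(insert 1 S) := ⟨1, by simp⟩
  have h0 := hfree i0
  set K := Subgroup.closure {x | ∃ i : ↥(insert 1 S), i ≠ i0 ∧ x = i.1 * f i} with hK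
  have := isCoatomic_subgroup_of_fg hfg
  have hKtop : K = ⊤ := by
    apply frattini_nongenerating
    rw [eq_top_iff, ← hS, Subgroup.closure_le]
    intro s hs
    by_cases hs1 : s = 1
    · rw [hs1]; exact Subgroup.one_mem _
    · let i : ↥(insert 1 S) := ⟨s, Finset.mem_insert_of_mem hs⟩
      have hi : i ≠ i0 := fun h => hs1 (congrArg Subtype.val h)
      have a1 : s * f i ∈ K := Subgroup.subset_closure ⟨i, hi, rfl⟩
      have : s = (s * f i) * (f i)⁻¹ := by group
      rw [this]
      exact Subgroup.mul_mem _ ((le_sup_left : K ≤ K ⊔ frattini Γ) a1)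
        ((le_sup_right : frattini Γ ≤ K ⊔ frattini Γ) (Subgroup.inv_mem _ (hfN i)))
  rw [hKtop] at h0
  exact h0 (Subgroup.mem_top _)

end HypLen

section word

variable {G : Type*} [Group G] (S : Set G)

lemma wordLength_le (l : List G) (hl : ∀ x ∈ l, x ∈ S ∨ x⁻¹ ∈ S) :
    wordLength S l.prod ≤ l.length :=
  Nat.sInf_le ⟨l, rfl, hl, rfl⟩

lemma exists_word (hS : Subgroup.closure S = ⊤) (g : G) :
    ∃ l : List G, l.length = wordLength S g ∧ (∀ x ∈ l, x ∈ S ∨ x⁻¹ ∈ S) ∧ l.prod = g := by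
  have hne : {n : ℕ | ∃ l : List G, l.length = n ∧ (∀ x ∈ l, x ∈ S ∨ x⁻¹ ∈ S) ∧ l.prod = g}.Nonempty := by
    have hg : g ∈ Subgroup.closure S := by rw [hS]; trivial
    rw [← Subgroup.mem_toSubmonoid, Subgroup.closure_toSubmonoid] at hg
    obtain ⟨l, hl, hp⟩ := Submonoid.exists_list_of_mem_closure hg
    exact ⟨l.length, l, rfl, hl, hp⟩
  exact Nat.sInf_mem hne

lemma wordLength_mul (hS : Subgroup.closure S = ⊤) (g h : G) :
    wordLength S (g * h) ≤ wordLength S g + wordLength S h := by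
  obtain ⟨l, h1, h2, h3⟩ := exists_word S hS g
  obtain ⟨l', h1', h2', h3'⟩ := exists_word S hS h
  have := wordLength_le S (l ++ l') (by
    intro x hx
    rcases List.mem_append.mp hx with hx | hx
    exacts [h2 x hx, h2' x hx])
  rw [List.prod_append, h3, h3', List.length_append] at this
  omega

lemma wordLength_inv_le (hS : Subgroup.closure S = ⊤) (g : G) :
    wordLength S g⁻¹ ≤ wordLength S g := by
  obtain ⟨l, h1, h2, h3⟩ := exists_word S hS g
  have := wordLength_le S ((l.map fun x => x⁻¹).reverse) (by
    intro x hx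
    rw [List.mem_reverse, List.mem_map] at hx
    obtain ⟨y, hy, rfl⟩ := hx
    rw [inv_inv]
    exact (h2 y hy).symm)
  rw [← List.prod_inv_reverse, h3] at this
  simpa [h1] using this

lemma wordLength_fin (hS : Subgroup.closure S = ⊤) (hfin : S.Finite) (r : ℕ) :
    {g : G | wordLength S g ≤ r}.Finite := by
  have hA : (S ∪ S⁻¹).Finite := hfin.union hfin.inv
  have : Finite ↥(S ∪ S⁻¹) := hA
  have hF : {l : List ↥(S ∪ S⁻¹) | l.length ≤ r}.Finite := List.finite_length_le _ r
  refine (hF.image fun l => (l.map Subtype.val).prod).subset ?_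
  intro g hg
  obtain ⟨l, h1, h2, h3⟩ := exists_word S hS g
  refine ⟨l.attach.map fun x => ⟨x.1, (h2 x.1 x.2).imp id id⟩, ?_, ?_⟩
  · simp only [Set.mem_ofPred_eq, List.length_map, List.length_attach] at hg ⊢; omega
  · simp [h3]

lemma wordLength_geod (hS : Subgroup.closure S = ⊤) (g : G) (n : ℕ) (hn : n ≤ wordLength S g) :
    ∃ x, wordLength S x = n ∧ wordLength S (x⁻¹ * g) + n = wordLength S g := by
  obtain ⟨l, h1, h2, h3⟩ := exists_word S hS g
  have e : (l.take n).prod * (l.drop n).prod = g := by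
    rw [← List.prod_append, List.take_append_drop, h3]
  have a1 := wordLength_le S (l.take n) (fun x hx => h2 x (List.mem_of_mem_take hx))
  have a2 := wordLength_le S (l.drop n) (fun x hx => h2 x (List.mem_of_mem_drop hx))
  have a3 := wordLength_mul S hS (l.take n).prod (l.drop n).prod
  rw [List.length_take] at a1
  rw [List.length_drop] at a2
  rw [e] at a3
  have e2 : (l.take n).prod⁻¹ * g = (l.drop n).prod := by rw [← e, inv_mul_cancel_left]
  refine ⟨(l.take n).prod, by omega, by rw [e2]; omega⟩

lemma wordLength_one : wordLength S (1 : G) = 0 := by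
  have := wordLength_le S ([] : List G) (by simp)
  simpa using this

/-- the hyperbolic length function of a word metric -/
noncomputable def wordHypLen (hS : Subgroup.closure S = ⊤) (hfin : S.Finite) (δ : ℝ)
    (h4 : GromovFourPoint S δ) : HypLen G where
  len := wordLength S
  D := ⌈2 * δ⌉₊
  len_one := wordLength_one S
  len_inv g := le_antisymm (wordLength_inv_le S hS g) (by
    simpa using wordLength_inv_le S hS g⁻¹)
  len_mul := wordLength_mul S hS
  fin := wordLength_fin S hS hfin
  four x y z w := by
    have h := h4 x y z w
    have hD : 2 * δ ≤ (⌈2 * δ⌉₊ : ℝ) := Nat.le_ceil _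
    unfold wordDist at h
    rcases max_choice ((wordLength S (x⁻¹ * z) : ℝ) + wordLength S (y⁻¹ * w))
      ((wordLength S (x⁻¹ * w) : ℝ) + wordLength S (y⁻¹ * z)) with e | e <;> rw [e] at h
    · left
      have : ((wordLength S (x⁻¹ * y) + wordLength S (z⁻¹ * w) : ℕ) : ℝ) ≤
          (wordLength S (x⁻¹ * z) + wordLength S (y⁻¹ * w) + ⌈2 * δ⌉₊ : ℕ) := by
        push_cast; linarith
      exact_mod_cast this
    · right
      have : ((wordLength S (x⁻¹ * y) + wordLength S (z⁻¹ * w) : ℕ) : ℝ) ≤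
          (wordLength S (x⁻¹ * w) + wordLength S (y⁻¹ * z) + ⌈2 * δ⌉₊ : ℕ) := by
        push_cast; linarith
      exact_mod_cast this

end word

theorem frattini_eq_bot_of_fg_torsionfree_subgroup_of_hyperbolic {G : Type*} [Group G]
    (hG : IsWordHyperbolic G) (H : Subgroup G) (hH : H.FG)
    (htf : ∀ h : H, h ≠ 1 → ¬IsOfFinOrder h) :
    frattini H = ⊥ := by
  obtain ⟨S, hS, δ, -, h4⟩ := hG
  have hfg : Group.FG H := (Group.fg_iff_subgroup_fg H).mpr hH
  by_contra hne
  obtain ⟨f, hf1⟩ := (Subgroup.ne_bot_iff_exists_ne_one.mp hne)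
  let L := wordHypLen (S : Set G) hS S.finite_toSet δ h4
  let N : Subgroup G := (frattini H).map H.subtype
  have hinf : (N : Set G).Infinite := by
    have hf1' : (f : H) ≠ 1 := fun h => hf1 (Subtype.ext h)
    have h1 := htf f hf1'
    have h2 : Function.Injective (fun n : ℕ => (f : H) ^ n) := injective_pow_iff_not_isOfFinOrder.mpr h1
    refine Set.infinite_of_injective_forall_mem (f := fun n : ℕ => (((f : H) ^ n : H) : G)) ?_ ?_
    · intro a b hab
      exact h2 (Subtype.ext hab)
    · intro n
      exact ⟨(f : H) ^ n, Subgroup.pow_mem _ f.2 n, rfl⟩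
  obtain ⟨x, g, hgN, hlox⟩ := L.exists_lox (wordLength_geod _ hS) N hinf
  obtain ⟨g', hg', rfl⟩ := hgN
  have hlox' : ((L.conj x).restrict H).Lox g' := hlox
  by_cases hE : HypLen.elem g' = ⊤
  · exact hne (hlox'.frattini_of_elem hfg htf hE)
  · exact hlox'.not_mem_frattini hfg htf hE hg'
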